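/- Exactly (q−1)³·q³·(q+1)²·(2q²+q+1) non-unimodular pairs (X,Y) ∈ ²T₃(q) generate a free cyclic submodule T₃(q)(X,Y). Moreover, each free cyclic submodule of ²T₃(q) generated by a non-unimodular pair is generated by exactly (q−1)³·q³ distinct non-unimodular pairs. -/

import Mathlib

open Matrix

/-- `Mat n F` is the type of `n × n` matrices over `F`. -/
abbrev Mat (n : ℕ) (F : Type) : Type := Matrix (Fin n) (Fin n) F

/-- A matrix is lower triangular (i.e. belongs to the ring `T_n(q)`)
if all entries above the diagonal vanish. -/
def LowerTri {n : ℕ} {F : Type} [Zero F] (X : Mat n F) : Prop :=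
  ∀ i j : Fin n, i < j → X i j = 0

/-- The cyclic left submodule `T_n(q)(X,Y)` of `²T_n(q)` generated by the pair `(X,Y)`. -/
def cyc {n : ℕ} {F : Type} [Field F] (X Y : Mat n F) : Set (Mat n F × Mat n F) :=
  {p | ∃ A : Mat n F, LowerTri A ∧ p = (A * X, A * Y)}

/-- The pair `(X,Y)` generates a *free* cyclic submodule:
`A • (X,Y) = (0,0)` with `A ∈ T_n(q)` forces `A = 0`. -/
def IsFreePair {n : ℕ} {F : Type} [Field F] (X Y : Mat n F) : Prop :=
  ∀ A : Mat n F, LowerTri A → A * X = 0 → A * Y = 0 → A = 0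

/-- A pair `(X,Y)` is unimodular if for every index `i` one of the `i`-th
diagonal entries of `X`, `Y` is nonzero. -/
def Unimodular {n : ℕ} {F : Type} [Field F] (X Y : Mat n F) : Prop :=
  ∀ i : Fin n, X i i ≠ 0 ∨ Y i i ≠ 0

/-- `M` is a free cyclic submodule of `²T_n(q)`. -/
def IsFreeCyc {n : ℕ} {F : Type} [Field F] (M : Set (Mat n F × Mat n F)) : Prop :=
  ∃ X Y : Mat n F, LowerTri X ∧ LowerTri Y ∧ IsFreePair X Y ∧ M = cyc X Y

/-- `M` is a free cyclic submodule of `²T_n(q)` generated by a non-unimodular pair. -/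
def IsNonUnimodFreeCyc {n : ℕ} {F : Type} [Field F] (M : Set (Mat n F × Mat n F)) : Prop :=
  ∃ X Y : Mat n F, LowerTri X ∧ LowerTri Y ∧ ¬ Unimodular X Y ∧ IsFreePair X Y ∧ M = cyc X Y


section LowerTriangular

variable {F : Type} [Field F]

/-- The lower triangular `3 × 3` matrix with the given entries. -/
def lowerMat (a b c d e f : F) : Mat 3 F := !![a, 0, 0; b, c, 0; d, e, f]

lemma lowerTri_lowerMat {a b c d e f : F} : LowerTri (lowerMat a b c d e f) := by
  intro i j h
  fin_cases i <;> fin_cases j <;> simp_all [lowerMat]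

lemma LowerTri.eq_lowerMat {X : Mat 3 F} (h : LowerTri X) :
    X = lowerMat (X 0 0) (X 1 0) (X 1 1) (X 2 0) (X 2 1) (X 2 2) := by
  ext i j
  fin_cases i <;> fin_cases j <;> simp [lowerMat] <;> exact h _ _ (by decide)

lemma lowerMat_mul (a b c d e f a' b' c' d' e' f' : F) :
    lowerMat a b c d e f * lowerMat a' b' c' d' e' f' =
      lowerMat (a * a') (b * a' + c * b') (c * c') (d * a' + e * b' + f * d')
        (e * c' + f * e') (f * f') := by
  ext i j
  fin_cases i <;> fin_cases j <;> simp [lowerMat, Matrix.mul_apply, Fin.sum_univ_three]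

lemma lowerMat_inj {a b c d e f a' b' c' d' e' f' : F} :
    lowerMat a b c d e f = lowerMat a' b' c' d' e' f' ↔
      a = a' ∧ b = b' ∧ c = c' ∧ d = d' ∧ e = e' ∧ f = f' := by
  refine ⟨fun h => ⟨?_, ?_, ?_, ?_, ?_, ?_⟩, by rintro ⟨rfl, rfl, rfl, rfl, rfl, rfl⟩; rfl⟩
  · simpa [lowerMat] using congrFun (congrFun h 0) 0
  · simpa [lowerMat] using congrFun (congrFun h 1) 0
  · simpa [lowerMat] using congrFun (congrFun h 1) 1
  · simpa [lowerMat] using congrFun (congrFun h 2) 0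
  · simpa [lowerMat] using congrFun (congrFun h 2) 1
  · simpa [lowerMat] using congrFun (congrFun h 2) 2

lemma lowerMat_zero : lowerMat (0 : F) 0 0 0 0 0 = 0 := by
  ext i j
  fin_cases i <;> fin_cases j <;> rfl

lemma lowerMat_one : lowerMat (1 : F) 0 1 0 0 1 = 1 := by
  ext i j
  fin_cases i <;> fin_cases j <;> simp [lowerMat]

lemma lowerMat_eq_zero {a b c d e f : F} :
    lowerMat a b c d e f = 0 ↔ a = 0 ∧ b = 0 ∧ c = 0 ∧ d = 0 ∧ e = 0 ∧ f = 0 := by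
  rw [← lowerMat_zero, lowerMat_inj]

lemma LowerTri.mul {A B : Mat 3 F} (hA : LowerTri A) (hB : LowerTri B) : LowerTri (A * B) := by
  rw [hA.eq_lowerMat, hB.eq_lowerMat, lowerMat_mul]
  exact lowerTri_lowerMat

lemma LowerTri.sub {A B : Mat 3 F} (hA : LowerTri A) (hB : LowerTri B) : LowerTri (A - B) :=
  fun i j h => by simp [hA i j h, hB i j h]

lemma lowerTri_one : LowerTri (1 : Mat 3 F) := fun _ _ h => Matrix.one_apply_ne h.ne

lemma LowerTri.mul_diag {A B : Mat 3 F} (hA : LowerTri A) (hB : LowerTri B) (i : Fin 3) :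
    (A * B) i i = A i i * B i i := by
  rw [hA.eq_lowerMat, hB.eq_lowerMat, lowerMat_mul]
  fin_cases i <;> simp [lowerMat]

lemma IsFreePair.eq_of_mul_eq {X Y A B : Mat 3 F} (h : IsFreePair X Y) (hA : LowerTri A)
    (hB : LowerTri B) (hX : A * X = B * X) (hY : A * Y = B * Y) : A = B :=
  sub_eq_zero.1 <| h _ (hA.sub hB) (by rw [sub_mul, hX, sub_self]) (by rw [sub_mul, hY, sub_self])

lemma cyc_mul_subset {X Y A : Mat 3 F} (hA : LowerTri A) : cyc (A * X) (A * Y) ⊆ cyc X Y := by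
  rintro _ ⟨B, hB, rfl⟩
  exact ⟨B * A, hB.mul hA, by simp only [mul_assoc]⟩

lemma self_mem_cyc (X Y : Mat 3 F) : (X, Y) ∈ cyc X Y := ⟨1, lowerTri_one, by simp⟩

/-- A lower triangular matrix with nonzero diagonal has a lower triangular left inverse. -/
lemma LowerTri.exists_mul_eq_one {A : Mat 3 F} (hA : LowerTri A) (h : ∀ i, A i i ≠ 0) :
    ∃ B, LowerTri B ∧ B * A = 1 := by
  have h0 := h 0
  have h1 := h 1
  have h2 := h 2
  rw [hA.eq_lowerMat, ← lowerMat_one]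
  generalize A 0 0 = a at *
  generalize A 1 1 = c at *
  generalize A 2 2 = f at *
  generalize A 1 0 = b at *
  generalize A 2 0 = d at *
  generalize A 2 1 = e at *
  refine ⟨lowerMat a⁻¹ (-(c⁻¹ * b * a⁻¹)) c⁻¹
    (-((-(f⁻¹ * e * c⁻¹)) * b + f⁻¹ * d) * a⁻¹) (-(f⁻¹ * e * c⁻¹)) f⁻¹, lowerTri_lowerMat, ?_⟩
  rw [lowerMat_mul, lowerMat_inj]
  refine ⟨?_, ?_, ?_, ?_, ?_, ?_⟩ <;> field_simp <;> ring

/-- The generating pairs of a free cyclic submodule are the multiples of a given generator by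
the lower triangular matrices with nonzero diagonal. -/
lemma IsFreePair.cyc_eq_iff {X Y P Q : Mat 3 F} (h : IsFreePair X Y) :
    cyc P Q = cyc X Y ↔ ∃ A, LowerTri A ∧ (∀ i, A i i ≠ 0) ∧ (P, Q) = (A * X, A * Y) := by
  constructor
  · intro hc
    obtain ⟨A, hA, hAP⟩ : (P, Q) ∈ cyc X Y := hc ▸ self_mem_cyc P Q
    obtain ⟨B, hB, hBX⟩ : (X, Y) ∈ cyc P Q := hc ▸ self_mem_cyc X Y
    obtain ⟨rfl, rfl⟩ := Prod.mk.inj hAP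
    obtain ⟨hX, hY⟩ := Prod.mk.inj hBX
    have hBA : B * A = 1 := h.eq_of_mul_eq (hB.mul hA) lowerTri_one
      (by rw [mul_assoc, ← hX, one_mul]) (by rw [mul_assoc, ← hY, one_mul])
    refine ⟨A, hA, fun i hi => ?_, rfl⟩
    have := hB.mul_diag hA i
    rw [hBA, hi, mul_zero, Matrix.one_apply_eq] at this
    exact one_ne_zero this
  · rintro ⟨A, hA, hd, hP⟩
    obtain ⟨rfl, rfl⟩ := Prod.mk.inj hP
    obtain ⟨B, hB, hBA⟩ := hA.exists_mul_eq_one hd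
    refine (cyc_mul_subset hA).antisymm ?_
    have := cyc_mul_subset (X := A * X) (Y := A * Y) hB
    rwa [← mul_assoc, ← mul_assoc, hBA, one_mul, one_mul] at this

lemma unimodular_mul_iff {X Y A : Mat 3 F} (hX : LowerTri X) (hY : LowerTri Y) (hA : LowerTri A)
    (hd : ∀ i, A i i ≠ 0) : Unimodular (A * X) (A * Y) ↔ Unimodular X Y := by
  simp [Unimodular, hA.mul_diag hX, hA.mul_diag hY, hd]

lemma ncard_lowerTri_diag_ne_zero [Fintype F] :
    {A : Mat 3 F | LowerTri A ∧ ∀ i, A i i ≠ 0}.ncard =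
      (Fintype.card F - 1) ^ 3 * Fintype.card F ^ 3 := by
  classical
  let g : (Fˣ × Fˣ × Fˣ) × F × F × F → Mat 3 F :=
    fun t => lowerMat t.1.1 t.2.1 t.1.2.1 t.2.2.1 t.2.2.2 t.1.2.2
  have hg : g.Injective := by
    rintro ⟨⟨a, c, f⟩, b, d, e⟩ ⟨⟨a', c', f'⟩, b', d', e'⟩ h
    simp only [g, lowerMat_inj, Units.val_inj] at h
    simp [h]
  have hr : {A : Mat 3 F | LowerTri A ∧ ∀ i, A i i ≠ 0} = Set.range g := by
    ext A
    constructor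
    · rintro ⟨hA, hd⟩
      exact ⟨((.mk0 _ (hd 0), .mk0 _ (hd 1), .mk0 _ (hd 2)), A 1 0, A 2 0, A 2 1),
        hA.eq_lowerMat.symm⟩
    · rintro ⟨t, rfl⟩
      refine ⟨lowerTri_lowerMat, fun i => ?_⟩
      fin_cases i <;> simp [g, lowerMat]
  rw [hr, ← Set.image_univ, Set.ncard_image_of_injective _ hg, Set.ncard_univ,
    Nat.card_eq_fintype_card]
  simp only [Fintype.card_prod, Fintype.card_units]
  ring

/-- A free cyclic submodule generated by a non-unimodular pair has as many (non-unimodular)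
generating pairs as there are units of the ring of lower triangular matrices. -/
lemma ncard_generators [Fintype F] {X Y : Mat 3 F} (hX : LowerTri X) (hY : LowerTri Y)
    (hu : ¬ Unimodular X Y) (h : IsFreePair X Y) :
    {p : Mat 3 F × Mat 3 F |
      LowerTri p.1 ∧ LowerTri p.2 ∧ ¬ Unimodular p.1 p.2 ∧ cyc p.1 p.2 = cyc X Y}.ncard =
      (Fintype.card F - 1) ^ 3 * Fintype.card F ^ 3 := by
  rw [← ncard_lowerTri_diag_ne_zero]
  have : {p : Mat 3 F × Mat 3 F |
      LowerTri p.1 ∧ LowerTri p.2 ∧ ¬ Unimodular p.1 p.2 ∧ cyc p.1 p.2 = cyc X Y} =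
      (fun A => (A * X, A * Y)) '' {A : Mat 3 F | LowerTri A ∧ ∀ i, A i i ≠ 0} := by
    ext ⟨P, Q⟩
    constructor
    · rintro ⟨-, -, -, hc⟩
      obtain ⟨A, hA, hd, hP⟩ := h.cyc_eq_iff.1 hc
      exact ⟨A, ⟨hA, hd⟩, hP.symm⟩
    · rintro ⟨A, ⟨hA, hd⟩, hP⟩
      obtain ⟨rfl, rfl⟩ := Prod.mk.inj hP
      exact ⟨hA.mul hX, hA.mul hY, (unimodular_mul_iff hX hY hA hd).not.2 hu,
        h.cyc_eq_iff.2 ⟨A, hA, hd, rfl⟩⟩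
  rw [this]
  refine Set.InjOn.ncard_image fun A hA B hB hAB => ?_
  obtain ⟨h1, h2⟩ := Prod.mk.inj hAB
  exact h.eq_of_mul_eq hA.1 hB.1 h1 h2

end LowerTriangular

section Counting

variable {F : Type} [Field F]

lemma ncard_prod_dependent {α β : Type} [Finite α] [Finite β] (S : Set α) (T : α → Set β)
    (m : ℕ) (h : ∀ a ∈ S, (T a).ncard = m) :
    {p : α × β | p.1 ∈ S ∧ p.2 ∈ T p.1}.ncard = S.ncard * m := by
  classical
  have := Fintype.ofFinite α
  have := Fintype.ofFinite β
  have e : {p : α × β | p.1 ∈ S ∧ p.2 ∈ T p.1} ≃ Σ a : S, T a.1 :=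
    { toFun := fun p => ⟨⟨p.1.1, p.2.1⟩, ⟨p.1.2, p.2.2⟩⟩
      invFun := fun p => ⟨(p.1.1, p.2.1), p.1.2, p.2.2⟩
      left_inv := fun _ => rfl
      right_inv := fun _ => rfl }
  rw [← Nat.card_coe_set_eq, Nat.card_congr e, Nat.card_sigma]
  simp only [Nat.card_coe_set_eq]
  rw [Finset.sum_congr rfl fun a _ => h a.1 a.2]
  simp [← Nat.card_eq_fintype_card, Nat.card_coe_set_eq]

lemma ncard_compl_range {α β : Type} [Finite α] [Finite β] {g : α → β} (hg : g.Injective) :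
    {b | ∀ a, g a ≠ b}.ncard = Nat.card β - Nat.card α := by
  have : {b | ∀ a, g a ≠ b} = (Set.range g)ᶜ := by ext; simp
  rw [this, Set.ncard_compl, ← Set.image_univ, Set.ncard_image_of_injective _ hg, Set.ncard_univ]

/-- The lower triangular parts of the three rows of a pair of lower triangular matrices, each
column of the pair being a vector of `F × F`. -/
abbrev Rows (F : Type) : Type :=
  ((F × F) × (F × F) × (F × F)) × (F × F) × (F × F) × (F × F)

/-- The pair of lower triangular matrices with given rows, listed as
`((r₁₁, r₂₁, r₂₂), (r₃₁, r₃₂, r₃₃))`. -/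
def pairOfRows (t : Rows F) : Mat 3 F × Mat 3 F :=
  (lowerMat t.1.1.1 t.1.2.1.1 t.1.2.2.1 t.2.1.1 t.2.2.1.1 t.2.2.2.1,
   lowerMat t.1.1.2 t.1.2.1.2 t.1.2.2.2 t.2.1.2 t.2.2.1.2 t.2.2.2.2)

lemma pairOfRows_injective : (pairOfRows (F := F)).Injective := by
  rintro ⟨⟨⟨_, _⟩, ⟨_, _⟩, ⟨_, _⟩⟩, ⟨_, _⟩, ⟨_, _⟩, ⟨_, _⟩⟩
    ⟨⟨⟨_, _⟩, ⟨_, _⟩, ⟨_, _⟩⟩, ⟨_, _⟩, ⟨_, _⟩, ⟨_, _⟩⟩ h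
  simp only [pairOfRows, Prod.mk.injEq, lowerMat_inj] at h
  simp [h]

lemma exists_pairOfRows {X Y : Mat 3 F} (hX : LowerTri X) (hY : LowerTri Y) :
    ∃ t, pairOfRows t = (X, Y) :=
  ⟨(((X 0 0, Y 0 0), (X 1 0, Y 1 0), (X 1 1, Y 1 1)),
    (X 2 0, Y 2 0), (X 2 1, Y 2 1), (X 2 2, Y 2 2)),
    Prod.ext hX.eq_lowerMat.symm hY.eq_lowerMat.symm⟩

lemma unimodular_pairOfRows (t : Rows F) :
    Unimodular (pairOfRows t).1 (pairOfRows t).2 ↔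
      t.1.1 ≠ 0 ∧ t.1.2.2 ≠ 0 ∧ t.2.2.2 ≠ 0 := by
  simp only [Unimodular, Fin.forall_fin_succ, pairOfRows, lowerMat, ne_eq, Prod.ext_iff,
    not_and_or]
  simp

/-- The combinations of the first two rows of a pair, inside the space of third rows. -/
def combine (t : (F × F) × (F × F) × (F × F)) (s : F × F) : (F × F) × (F × F) × (F × F) :=
  s.1 • (t.1, 0, 0) + s.2 • (t.2.1, t.2.2, 0)

/-- The first two rows of a pair are linearly independent. -/
def firstRowsIndep (F : Type) [Field F] : Set ((F × F) × (F × F) × (F × F)) :=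
  {t | t.1 ∈ ({0}ᶜ : Set (F × F)) ∧ t.2 ∈ {r : (F × F) × (F × F) | ∀ s : F, s • (t.1, 0) ≠ r}}

lemma combine_injective {t : (F × F) × (F × F) × (F × F)} (ht : t ∈ firstRowsIndep F) :
    (combine t).Injective := by
  obtain ⟨v, u, w⟩ := t
  obtain ⟨h1, h2⟩ := ht
  have hv : ((v, 0, 0) : (F × F) × (F × F) × (F × F)) ≠ 0 := by simpa using h1
  have hi : LinearIndependent F ![((v, 0, 0) : (F × F) × (F × F) × (F × F)), (u, w, 0)] := by
    refine (LinearIndependent.pair_iff' hv).2 fun a ha => h2 a ?_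
    simp only [Prod.smul_mk, Prod.mk.injEq] at ha ⊢
    exact ⟨ha.1, ha.2.1⟩
  rintro ⟨s, t⟩ ⟨s', t'⟩ h
  exact Prod.ext_iff.2 (hi.eq_of_pair h)

lemma isFreePair_pairOfRows (t : Rows F) :
    IsFreePair (pairOfRows t).1 (pairOfRows t).2 ↔
      t.1 ∈ firstRowsIndep F ∧ t.2 ∈ {r | ∀ s, combine t.1 s ≠ r} := by
  obtain ⟨⟨⟨v, v'⟩, ⟨u, u'⟩, ⟨w, w'⟩⟩, ⟨a, a'⟩, ⟨b, b'⟩, ⟨c, c'⟩⟩ := t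
  constructor
  · intro h
    have key := fun x y z x' y' z' =>
      h (lowerMat x y z x' y' z') lowerTri_lowerMat
    simp only [pairOfRows, lowerMat_mul, lowerMat_eq_zero] at key
    refine ⟨⟨fun h0 => ?_, fun s hs => ?_⟩, fun s hs => ?_⟩
    · obtain ⟨rfl, rfl⟩ := Prod.mk.inj (Set.mem_singleton_iff.1 h0)
      simpa using key 1 0 0 0 0 0
    · simp only [Prod.smul_mk, Prod.mk.injEq, smul_eq_mul, Prod.zero_eq_mk] at hs
      obtain ⟨⟨rfl, rfl⟩, rfl, rfl⟩ := hs
      simpa using key 0 s (-1) 0 0 0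
    · simp only [combine, Prod.smul_mk, Prod.mk_add_mk, Prod.mk.injEq, smul_eq_mul,
        Prod.zero_eq_mk] at hs
      obtain ⟨⟨rfl, rfl⟩, ⟨rfl, rfl⟩, rfl, rfl⟩ := hs
      simpa using key 0 0 0 s.1 s.2 (-1)
  · rintro ⟨⟨h1, h2⟩, h3⟩ A hA hX hY
    rw [hA.eq_lowerMat] at hX hY ⊢
    generalize A 0 0 = x at *
    generalize A 1 0 = y at *
    generalize A 1 1 = z at *
    generalize A 2 0 = x' at *
    generalize A 2 1 = y' at *
    generalize A 2 2 = z' at *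
    simp only [pairOfRows, lowerMat_mul, lowerMat_eq_zero] at hX hY ⊢
    obtain ⟨hX1, hX2, hX3, hX4, hX5, hX6⟩ := hX
    obtain ⟨hY1, hY2, hY3, hY4, hY5, hY6⟩ := hY
    have hv : ∀ x : F, x * v = 0 → x * v' = 0 → x = 0 := by
      intro x hx hx'
      by_contra h0
      simp_all
    have hr : ∀ y z : F, y * v + z * u = 0 → y * v' + z * u' = 0 → z * w = 0 → z * w' = 0 →
        y = 0 ∧ z = 0 := by
      intro y z e1 e2 e3 e4
      have hz : z = 0 := by
        by_contra h0
        have e3' : w = 0 := by simpa [h0] using e3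
        have e4' : w' = 0 := by simpa [h0] using e4
        refine h2 (-y / z) ?_
        simp only [Prod.smul_mk, smul_eq_mul, e3', e4', Prod.mk.injEq, smul_zero]
        refine ⟨⟨?_, ?_⟩, rfl⟩ <;> field_simp
        · linear_combination -e1
        · linear_combination -e2
      subst hz
      exact ⟨hv y (by simpa using e1) (by simpa using e2), rfl⟩
    have hz' : z' = 0 := by
      by_contra h0
      have e1 : c = 0 := by simpa [h0] using hX6
      have e2 : c' = 0 := by simpa [h0] using hY6
      refine h3 (-x' / z', -y' / z') ?_
      simp only [combine, Prod.smul_mk, smul_eq_mul, e1, e2, Prod.mk.injEq, smul_zero,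
        Prod.mk_add_mk, zero_add, Prod.mk_zero_zero]
      refine ⟨⟨?_, ?_⟩, ⟨?_, ?_⟩, trivial⟩ <;> field_simp
      · linear_combination -hX4
      · linear_combination -hY4
      · linear_combination -hX5
      · linear_combination -hY5
    subst hz'
    obtain ⟨rfl, rfl⟩ := hr y z hX2 hY2 hX3 hY3
    obtain ⟨rfl, rfl⟩ := hr x' y' (by simpa using hX4) (by simpa using hY4) (by simpa using hX5)
      (by simpa using hY5)
    exact ⟨hv x hX1 hY1, rfl, rfl, rfl, rfl, rfl⟩

lemma Unimodular.isFreePair_pairOfRows {t : Rows F}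
    (h : Unimodular (pairOfRows t).1 (pairOfRows t).2) :
    IsFreePair (pairOfRows t).1 (pairOfRows t).2 := by
  rw [unimodular_pairOfRows] at h
  obtain ⟨h1, h2, h3⟩ := h
  refine (_root_.isFreePair_pairOfRows t).2 ⟨⟨h1, fun s hs => h2 ?_⟩, fun s hs => h3 ?_⟩
  · simpa using (congrArg Prod.snd hs).symm
  · simpa [combine] using (congrArg (fun r => r.2.2) hs).symm

variable [Fintype F]

lemma ncard_compl_singleton_zero : ({0}ᶜ : Set (F × F)).ncard = Fintype.card F ^ 2 - 1 := by
  rw [Set.ncard_compl, Set.ncard_singleton, Nat.card_eq_fintype_card, Fintype.card_prod, sq]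

lemma ncard_firstRowsIndep :
    (firstRowsIndep F).ncard =
      (Fintype.card F ^ 2 - 1) * (Fintype.card F ^ 4 - Fintype.card F) := by
  rw [firstRowsIndep, ncard_prod_dependent ({0}ᶜ : Set (F × F))
    (fun v => {r : (F × F) × (F × F) | ∀ s : F, s • (v, 0) ≠ r})
    (Fintype.card F ^ 4 - Fintype.card F), ncard_compl_singleton_zero]
  intro v hv
  have hv' : ((v, 0) : (F × F) × (F × F)) ≠ 0 := by simpa using hv
  rw [ncard_compl_range (smul_left_injective F hv')]
  simp only [Nat.card_eq_fintype_card, Fintype.card_prod]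
  ring_nf

lemma ncard_free_rows :
    {t : Rows F | IsFreePair (pairOfRows t).1 (pairOfRows t).2}.ncard =
      (Fintype.card F ^ 2 - 1) * (Fintype.card F ^ 4 - Fintype.card F) *
        (Fintype.card F ^ 6 - Fintype.card F ^ 2) := by
  simp only [isFreePair_pairOfRows]
  rw [ncard_prod_dependent (firstRowsIndep F) (fun t => {r | ∀ s, combine t s ≠ r})
    (Fintype.card F ^ 6 - Fintype.card F ^ 2), ncard_firstRowsIndep]
  intro t ht
  rw [ncard_compl_range (combine_injective ht)]
  simp only [Nat.card_eq_fintype_card, Fintype.card_prod]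
  ring_nf

lemma ncard_unimodular_rows :
    {t : Rows F | Unimodular (pairOfRows t).1 (pairOfRows t).2}.ncard =
      (Fintype.card F ^ 2 - 1) ^ 3 * Fintype.card F ^ 6 := by
  have : {t : Rows F | Unimodular (pairOfRows t).1 (pairOfRows t).2} =
      (({0}ᶜ : Set (F × F)) ×ˢ (Set.univ : Set (F × F)) ×ˢ ({0}ᶜ : Set (F × F))) ×ˢ
        (Set.univ : Set (F × F)) ×ˢ (Set.univ : Set (F × F)) ×ˢ ({0}ᶜ : Set (F × F)) := by
    ext t
    simp only [Set.mem_ofPred_eq, unimodular_pairOfRows, Set.mem_prod, Set.mem_compl_iff,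
      Set.mem_singleton_iff, Set.mem_univ, true_and, and_assoc, ne_eq]
  rw [this]
  simp only [Set.ncard_prod, ncard_compl_singleton_zero, Set.ncard_univ,
    Nat.card_eq_fintype_card, Fintype.card_prod]
  ring

lemma ncard_nonunimodular_free :
    {p : Mat 3 F × Mat 3 F |
      LowerTri p.1 ∧ LowerTri p.2 ∧ ¬ Unimodular p.1 p.2 ∧ IsFreePair p.1 p.2}.ncard =
      (Fintype.card F ^ 2 - 1) * (Fintype.card F ^ 4 - Fintype.card F) *
        (Fintype.card F ^ 6 - Fintype.card F ^ 2) -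
      (Fintype.card F ^ 2 - 1) ^ 3 * Fintype.card F ^ 6 := by
  have : {p : Mat 3 F × Mat 3 F |
      LowerTri p.1 ∧ LowerTri p.2 ∧ ¬ Unimodular p.1 p.2 ∧ IsFreePair p.1 p.2} =
      pairOfRows '' ({t : Rows F | IsFreePair (pairOfRows t).1 (pairOfRows t).2} \
        {t : Rows F | Unimodular (pairOfRows t).1 (pairOfRows t).2}) := by
    ext ⟨X, Y⟩
    constructor
    · rintro ⟨hX, hY, hu, h⟩
      obtain ⟨t, ht⟩ := exists_pairOfRows hX hY
      exact ⟨t, by simpa [ht] using ⟨h, hu⟩, ht⟩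
    · rintro ⟨t, ⟨h, hu⟩, ht⟩
      rw [← ht]
      exact ⟨lowerTri_lowerMat, lowerTri_lowerMat, hu, h⟩
  have hs : {t : Rows F | Unimodular (pairOfRows t).1 (pairOfRows t).2} ⊆
      {t : Rows F | IsFreePair (pairOfRows t).1 (pairOfRows t).2} :=
    fun t ht => Unimodular.isFreePair_pairOfRows ht
  rw [this, Set.ncard_image_of_injective _ pairOfRows_injective,
    Set.ncard_sdiff hs, ncard_free_rows,
    ncard_unimodular_rows]

end Counting

lemma free_sub_unimodular_count (q : ℕ) (hq : 2 ≤ q) :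
    (q ^ 2 - 1) * (q ^ 4 - q) * (q ^ 6 - q ^ 2) - (q ^ 2 - 1) ^ 3 * q ^ 6 =
      (q - 1) ^ 3 * q ^ 3 * (q + 1) ^ 2 * (2 * q ^ 2 + q + 1) := by
  obtain ⟨k, rfl⟩ : ∃ k, q = k + 1 := ⟨q - 1, by omega⟩
  have h2 : (k + 1) ^ 2 - 1 = k * (k + 2) := Nat.sub_eq_of_eq_add (by ring)
  have h4 : (k + 1) ^ 4 - (k + 1) = (k + 1) * (k * (k ^ 2 + 3 * k + 3)) :=
    Nat.sub_eq_of_eq_add (by ring)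
  have h6 : (k + 1) ^ 6 - (k + 1) ^ 2 = (k + 1) ^ 2 * (k * (k + 2) * ((k + 1) ^ 2 + 1)) :=
    Nat.sub_eq_of_eq_add (by ring)
  rw [h2, h4, h6, Nat.add_sub_cancel]
  exact Nat.sub_eq_of_eq_add (by ring)

theorem stmt_14 (q : ℕ) (hq : 2 ≤ q)
    (F : Type) [Field F] [Fintype F] (hF : Fintype.card F = q) :
    Set.ncard {p : Mat 3 F × Mat 3 F |
        LowerTri p.1 ∧ LowerTri p.2 ∧ ¬ Unimodular p.1 p.2 ∧ IsFreePair p.1 p.2}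
      = (q - 1) ^ 3 * q ^ 3 * (q + 1) ^ 2 * (2 * q ^ 2 + q + 1) ∧
    ∀ M : Set (Mat 3 F × Mat 3 F), IsNonUnimodFreeCyc M →
      Set.ncard {p : Mat 3 F × Mat 3 F |
          LowerTri p.1 ∧ LowerTri p.2 ∧ ¬ Unimodular p.1 p.2 ∧ cyc p.1 p.2 = M}
        = (q - 1) ^ 3 * q ^ 3 := by
  subst hF
  refine ⟨ncard_nonunimodular_free.trans (free_sub_unimodular_count _ hq), ?_⟩
  rintro M ⟨X, Y, hX, hY, hu, h, rfl⟩
  exact ncard_generators hX hY hu h
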